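/- In the algebra R = K⟨x,y⟩/(x², y³, (x+y)³), the element x·y·x·y·y is nonzero, and the twelve monomials 1, x, y, xy, yx, yy, xyx, xyy, yxy, xyxy, yxyy, xyxyy form a K-basis of R; in particular dim_K R = 12. -/

import Mathlib

noncomputable section

open FreeAlgebra

/-- The defining relations of `R(E₆) = K⟨x,y⟩/(x², y³, (x+y)³)`. -/
inductive RRel (K : Type*) [Field K] :
    FreeAlgebra K (Fin 2) → FreeAlgebra K (Fin 2) → Prop
  | xx : RRel K (ι K (0 : Fin 2) * ι K 0) 0
  | yyy : RRel K (ι K (1 : Fin 2) * ι K 1 * ι K 1) 0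
  | xy3 : RRel K ((ι K (0 : Fin 2) + ι K 1) ^ 3) 0

/-- `R(E₆) = K⟨x,y⟩/(x², y³, (x+y)³)`. -/
abbrev RE6 (K : Type*) [Field K] := RingQuot (RRel K)

/-- The image of `x` in `R(E₆)`. -/
def rx (K : Type*) [Field K] : RE6 K := RingQuot.mkAlgHom K (RRel K) (ι K 0)

/-- The image of `y` in `R(E₆)`. -/
def ry (K : Type*) [Field K] : RE6 K := RingQuot.mkAlgHom K (RRel K) (ι K 1)

variable (K : Type*) [Field K] [IsAlgClosed K]

/-- The twelve monomials `1, x, y, xy, yx, yy, xyx, xyy, yxy, xyxy, yxyy, xyxyy`. -/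
def basisMonomials : Fin 12 → RE6 K :=
  ![1, rx K, ry K,
    rx K * ry K, ry K * rx K, ry K * ry K,
    rx K * ry K * rx K, rx K * ry K * ry K, ry K * rx K * ry K,
    rx K * ry K * rx K * ry K, ry K * rx K * ry K * ry K,
    rx K * ry K * rx K * ry K * ry K]

/-- Left multiplication by `x` in coordinates with respect to the twelve monomials. -/
def leftMulX (F : Type*) [Field F] : Module.End F (Fin 12 → F) where
  toFun v := ![0, v 0, 0, v 2, 0, 0, v 4, v 5, 0, v 8, 0, v 10]
  map_add' u v := by ext i; fin_cases i <;> simp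
  map_smul' c v := by ext i; fin_cases i <;> simp

/-- Left multiplication by `y` in coordinates with respect to the twelve monomials. -/
def leftMulY (F : Type*) [Field F] : Module.End F (Fin 12 → F) where
  toFun v := ![0, 0, v 0, 0, v 1, v 2, -v 4, -v 4, v 3 - v 4, v 6 - v 8, v 7 - v 8, v 9 - v 10]
  map_add' u v := by ext i; fin_cases i <;> simp <;> ring
  map_smul' c v := by ext i; fin_cases i <;> simp [mul_sub]

theorem leftMulX_apply (F : Type*) [Field F] (v : Fin 12 → F) :
    leftMulX F v = ![0, v 0, 0, v 2, 0, 0, v 4, v 5, 0, v 8, 0, v 10] := rfl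

theorem leftMulY_apply (F : Type*) [Field F] (v : Fin 12 → F) :
    leftMulY F v = ![0, 0, v 0, 0, v 1, v 2, -v 4, -v 4, v 3 - v 4, v 6 - v 8, v 7 - v 8,
      v 9 - v 10] := rfl

/-- The action of `R(E₆)` on coordinate vectors given by `leftMulX` and `leftMulY`. -/
def leftRegular (F : Type*) [Field F] : RE6 F →ₐ[F] Module.End F (Fin 12 → F) :=
  RingQuot.liftAlgHom F ⟨FreeAlgebra.lift F ![leftMulX F, leftMulY F], by
    rintro _ _ (_ | _ | _)
    · refine LinearMap.ext fun v => funext fun i => ?_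
      fin_cases i <;> simp [leftMulX_apply]
    · refine LinearMap.ext fun v => funext fun i => ?_
      fin_cases i <;> simp [leftMulY_apply]
    · refine LinearMap.ext fun v => funext fun i => ?_
      fin_cases i <;> simp [pow_succ, leftMulX_apply, leftMulY_apply]⟩

theorem leftRegular_rx (F : Type*) [Field F] : leftRegular F (rx F) = leftMulX F := by
  simp [leftRegular, rx]

theorem leftRegular_ry (F : Type*) [Field F] : leftRegular F (ry F) = leftMulY F := by
  simp [leftRegular, ry]

theorem rx_mul_rx (F : Type*) [Field F] : rx F * rx F = 0 := by
  simpa [rx] using RingQuot.mkAlgHom_rel F (RRel.xx (K := F))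

theorem ry_mul_ry_mul_ry (F : Type*) [Field F] : ry F * ry F * ry F = 0 := by
  simpa [ry] using RingQuot.mkAlgHom_rel F (RRel.yyy (K := F))

theorem rx_add_ry_pow_three (F : Type*) [Field F] : (rx F + ry F) ^ 3 = 0 := by
  simpa [rx, ry] using RingQuot.mkAlgHom_rel F (RRel.xy3 (K := F))

/-- A submodule containing `1` and stable under left multiplication by `x` and `y` is everything. -/
theorem submodule_eq_top_of_left_stable {F : Type*} [Field F] (S : Submodule F (RE6 F))
    (one_mem : 1 ∈ S) (hx : ∀ a ∈ S, rx F * a ∈ S) (hy : ∀ a ∈ S, ry F * a ∈ S) : S = ⊤ := by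
  suffices h : ∀ w : FreeAlgebra F (Fin 2), ∀ a ∈ S, RingQuot.mkAlgHom F (RRel F) w * a ∈ S by
    refine eq_top_iff.2 fun r _ => ?_
    obtain ⟨w, rfl⟩ := RingQuot.mkAlgHom_surjective F (RRel F) r
    simpa using h w 1 one_mem
  intro w
  induction w using FreeAlgebra.induction with
  | grade0 c =>
    intro a ha
    simpa [← Algebra.smul_def] using S.smul_mem c ha
  | grade1 i =>
    fin_cases i
    · exact hx
    · exact hy
  | mul u v hu hv =>
    intro a ha
    rw [map_mul, mul_assoc]
    exact hu _ (hv a ha)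
  | add u v hu hv =>
    intro a ha
    rw [map_add, add_mul]
    exact S.add_mem (hu a ha) (hv a ha)

section Relations

variable {A : Type*} [Ring A] {x y : A}

theorem yyx_eq (hx : x * x = 0) (hy : y * y * y = 0) (hxy : (x + y) ^ 3 = 0) :
    y * (y * x) = -(x * (y * x)) - x * (y * y) - y * (x * y) := by
  have h : (x + y) ^ 3 = x * x * x + x * x * y + y * (x * x) + y * y * y
      + (y * (y * x) + x * (y * x) + x * (y * y) + y * (x * y)) := by noncomm_ring
  rw [hxy, hx, hy] at h
  simp only [zero_mul, mul_zero, zero_add] at h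
  rw [← sub_eq_zero]
  refine Eq.trans ?_ h.symm
  abel

theorem yyxy_eq (hx : x * x = 0) (hy : y * y * y = 0) (hxy : (x + y) ^ 3 = 0) :
    y * (y * (x * y)) = -(x * (y * (x * y))) - y * (x * (y * y)) := by
  have h := congrArg (· * y) (yyx_eq hx hy hxy)
  have hy' : y * (y * y) = 0 := by rw [← mul_assoc, hy]
  simpa [sub_mul, mul_assoc, hy'] using h

theorem yxyx_eq (hx : x * x = 0) (hy : y * y * y = 0) (hxy : (x + y) ^ 3 = 0) :
    y * (x * (y * x)) = x * (y * (x * y)) := by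
  have h := congrArg (y * ·) (yyx_eq hx hy hxy)
  have hy' : y * (y * (y * x)) = 0 := by rw [← mul_assoc, ← mul_assoc, hy, zero_mul]
  simp only [hy', mul_sub, mul_neg, yyxy_eq hx hy hxy] at h
  rw [← sub_eq_zero, ← neg_eq_zero, h]
  abel

theorem yxyxy_eq (hx : x * x = 0) (hy : y * y * y = 0) (hxy : (x + y) ^ 3 = 0) :
    y * (x * (y * (x * y))) = x * (y * (x * (y * y))) := by
  simpa [mul_assoc] using congrArg (· * y) (yxyx_eq hx hy hxy)

theorem yyxyy_eq (hx : x * x = 0) (hy : y * y * y = 0) (hxy : (x + y) ^ 3 = 0) :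
    y * (y * (x * (y * y))) = -(x * (y * (x * (y * y)))) := by
  have h := congrArg (· * y) (yyxy_eq hx hy hxy)
  have hy' : y * (y * y) = 0 := by rw [← mul_assoc, hy]
  simpa [sub_mul, mul_assoc, hy'] using h

theorem yxyxyy_eq (hx : x * x = 0) (hy : y * y * y = 0) (hxy : (x + y) ^ 3 = 0) :
    y * (x * (y * (x * (y * y)))) = 0 := by
  have h := congrArg (· * y) (yxyxy_eq hx hy hxy)
  have hy' : y * (y * y) = 0 := by rw [← mul_assoc, hy]
  simpa [mul_assoc, hy'] using h

end Relations

theorem span_basisMonomials (F : Type*) [Field F] :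
    Submodule.span F (Set.range (basisMonomials F)) = ⊤ := by
  have hx := rx_mul_rx F
  have hy := ry_mul_ry_mul_ry F
  have hxy := rx_add_ry_pow_three F
  have hx' (a : RE6 F) : rx F * (rx F * a) = 0 := by rw [← mul_assoc, hx, zero_mul]
  have hy' : ry F * (ry F * ry F) = 0 := by rw [← mul_assoc, hy]
  have mem (i : Fin 12) : basisMonomials F i ∈ Submodule.span F (Set.range (basisMonomials F)) :=
    Submodule.subset_span ⟨i, rfl⟩
  generalize hS : Submodule.span F (Set.range (basisMonomials F)) = S at mem
  have m0 := mem 0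
  have m1 := mem 1
  have m2 := mem 2
  have m3 := mem 3
  have m4 := mem 4
  have m5 := mem 5
  have m6 := mem 6
  have m7 := mem 7
  have m8 := mem 8
  have m9 := mem 9
  have m10 := mem 10
  have m11 := mem 11
  simp [basisMonomials, mul_assoc] at m0 m1 m2 m3 m4 m5 m6 m7 m8 m9 m10 m11
  have stable (r : RE6 F) (h : ∀ i, r * basisMonomials F i ∈ S) : ∀ a ∈ S, r * a ∈ S := by
    have hle : S ≤ S.comap (LinearMap.mulLeft F r) := by
      conv_lhs => rw [← hS]
      rw [Submodule.span_le]
      rintro _ ⟨i, rfl⟩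
      exact h i
    exact fun a ha => hle ha
  refine submodule_eq_top_of_left_stable S m0 (stable _ fun i => ?_) (stable _ fun i => ?_)
  · fin_cases i <;> simp [basisMonomials, mul_assoc, *]
  · fin_cases i <;> simp [basisMonomials, mul_assoc, hy', yyx_eq hx hy hxy, yyxy_eq hx hy hxy,
      yxyx_eq hx hy hxy, yxyxy_eq hx hy hxy, yyxyy_eq hx hy hxy, yxyxyy_eq hx hy hxy,
      S.sub_mem, S.neg_mem, m2, m4, m5, m6, m7, m8, m9, m10, m11]

theorem leftRegular_basisMonomials (F : Type*) [Field F] (i : Fin 12) :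
    leftRegular F (basisMonomials F i) (Pi.single 0 1) = Pi.single i 1 := by
  fin_cases i <;> ext j <;> fin_cases j <;>
    simp [basisMonomials, leftRegular_rx, leftRegular_ry, leftMulX_apply, leftMulY_apply]

theorem linearIndependent_basisMonomials (F : Type*) [Field F] :
    LinearIndependent F (basisMonomials F) := by
  refine LinearIndependent.of_comp
    ((LinearMap.applyₗ (Pi.single 0 1)).comp (leftRegular F).toLinearMap) ?_
  convert (Pi.basisFun F (Fin 12)).linearIndependent using 1
  ext1 i
  simpa using leftRegular_basisMonomials F i

theorem twelve_monomials_basis :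
    rx K * ry K * rx K * ry K * ry K ≠ 0 ∧
    LinearIndependent K (basisMonomials K) ∧
    Submodule.span K (Set.range (basisMonomials K)) = ⊤ ∧
    Module.finrank K (RE6 K) = 12 := by
  have li := linearIndependent_basisMonomials K
  have sp := span_basisMonomials K
  refine ⟨li.ne_zero 11, li, sp, ?_⟩
  simpa using Module.finrank_eq_card_basis (Module.Basis.mk li sp.ge)
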